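/- Fix an integer r ≥ 3 and an integer n ≥ 3, and let P = P(c(n+1), c n). Let CP_bad(P) be the set of compatible pairs (S_1,S_2) on P with r·|S_2| > c(n+1). Then 2^{c(n−2)} · |CP_bad(P)| ≤ |CP(P)|. -/

import Mathlib

namespace CPwork

/-! ## The maximal Dyck path `P(ℓ,h)`

The maximal Dyck path `P(ℓ,h)` is the lattice path from `(0,0)` to `(ℓ,h)` of unit east
and north steps never passing strictly above the main diagonal which is pointwise highest;
concretely, immediately after its `i`-th east step the path has taken exactly `⌊i·h/ℓ⌋`
north steps.  We encode the path by recording, for each edge, its (1-based) position in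
the sequence of `ℓ + h` steps.  Horizontal (east) edges are labelled `η_1, …, η_ℓ` from
left to right and vertical (north) edges `ν_1, …, ν_h` from bottom to top.  The lattice
points of the path are `w_0, …, w_{ℓ+h}`, where `w_k` is the point reached after `k` steps.
-/

/-- The number of north steps taken immediately after (equivalently, immediately before)
the `i`-th east step of `P(ℓ,h)`, namely `⌊i·h/ℓ⌋`. -/
def northBefore (ℓ h i : ℕ) : ℕ := i * h / ℓ

/-- The number of east steps preceding the `j`-th north step of `P(ℓ,h)`. -/
def eastBefore (ℓ h j : ℕ) : ℕ :=
  ((Finset.Icc 1 ℓ).filter fun i => northBefore ℓ h i < j).card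

/-- The (1-based) position of the horizontal edge `η_i` in the step sequence of `P(ℓ,h)`. -/
def posE (ℓ h i : ℕ) : ℕ := i + northBefore ℓ h i

/-- The (1-based) position of the vertical edge `ν_j` in the step sequence of `P(ℓ,h)`. -/
def posN (ℓ h j : ℕ) : ℕ := j + eastBefore ℓ h j

/-- The index of the lattice point `p_{η_i}` (the left endpoint of `η_i`). -/
def pE (ℓ h i : ℕ) : ℕ := posE ℓ h i - 1

/-- The index of the lattice point `p_{ν_j}` (the top endpoint of `ν_j`). -/
def pN (ℓ h j : ℕ) : ℕ := posN ℓ h j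

/-- The positions of the edges of the subpath `→ w_a w_b` of `P(ℓ,h)` proceeding east
from the lattice point `w_a` to the lattice point `w_b`, continuing cyclically around
the path if `a > b`. -/
def steps (ℓ h a b : ℕ) : Finset ℕ :=
  if a ≤ b then Finset.Icc (a + 1) b
  else Finset.Icc (a + 1) (ℓ + h) ∪ Finset.Icc 1 b

/-- The indices of the lattice points of the subpath `→ w_a w_b`. -/
def pts (ℓ h a b : ℕ) : Finset ℕ :=
  if a ≤ b then Finset.Icc a b
  else Finset.Icc a (ℓ + h) ∪ Finset.Icc 0 b

/-- The number of horizontal edges of `P(ℓ,h)` whose position lies in `E`. -/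
def hIn (ℓ h : ℕ) (E : Finset ℕ) : ℕ :=
  ((Finset.Icc 1 ℓ).filter fun i => posE ℓ h i ∈ E).card

/-- The number of vertical edges of `P(ℓ,h)` whose position lies in `E`. -/
def vIn (ℓ h : ℕ) (E : Finset ℕ) : ℕ :=
  ((Finset.Icc 1 h).filter fun j => posN ℓ h j ∈ E).card

/-- The number of horizontal edges of `S1` whose position lies in `E`. -/
def hInS (ℓ h : ℕ) (S1 E : Finset ℕ) : ℕ :=
  (S1.filter fun i => posE ℓ h i ∈ E).card

/-- The number of vertical edges of `S2` whose position lies in `E`. -/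
def vInS (ℓ h : ℕ) (S2 E : Finset ℕ) : ℕ :=
  (S2.filter fun j => posN ℓ h j ∈ E).card

/-- A pair `(S1, S2)` of a set `S1` of (indices of) horizontal edges and a set `S2`
of (indices of) vertical edges of `P(ℓ,h)` is *compatible* if for every `η_i ∈ S1`
and `ν_j ∈ S2` there is a lattice point `t = w_m ≠ p_{η_i}, p_{ν_j}` on the subpath
`→ p_{η_i} p_{ν_j}` with `|t p_{ν_j}|_1 = r·|→ t p_{ν_j} ∩ S2|` or
`|p_{η_i} t|_2 = r·|→ p_{η_i} t ∩ S1|`. -/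
def Compatible (r : ℤ) (ℓ h : ℕ) (S1 S2 : Finset ℕ) : Prop :=
  S1 ⊆ Finset.Icc 1 ℓ ∧ S2 ⊆ Finset.Icc 1 h ∧
  ∀ i ∈ S1, ∀ j ∈ S2,
    ∃ m ∈ pts ℓ h (pE ℓ h i) (pN ℓ h j),
      m ≠ pE ℓ h i ∧ m ≠ pN ℓ h j ∧
      ((hIn ℓ h (steps ℓ h m (pN ℓ h j)) : ℤ)
          = r * (vInS ℓ h S2 (steps ℓ h m (pN ℓ h j)) : ℤ) ∨
        (vIn ℓ h (steps ℓ h (pE ℓ h i) m) : ℤ)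
          = r * (hInS ℓ h S1 (steps ℓ h (pE ℓ h i) m) : ℤ))

open scoped Classical in
/-- `CP r ℓ h` is the set of all compatible pairs on the maximal Dyck path `P(ℓ,h)`. -/
noncomputable def CP (r : ℤ) (ℓ h : ℕ) : Finset (Finset ℕ × Finset ℕ) :=
  ((Finset.Icc 1 ℓ).powerset ×ˢ (Finset.Icc 1 h).powerset).filter fun p =>
    Compatible r ℓ h p.1 p.2

/-- `CPab r ℓ h a b` is the set of compatible pairs `(S1,S2)` on `P(ℓ,h)` with
`|S1| = a` and `|S2| = b`; it is empty if `a < 0` or `b < 0`. -/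
noncomputable def CPab (r : ℤ) (ℓ h : ℕ) (a b : ℤ) : Finset (Finset ℕ × Finset ℕ) :=
  (CP r ℓ h).filter fun p => (p.1.card : ℤ) = a ∧ (p.2.card : ℤ) = b

/-- The number of labels `i ∈ S` whose position `pos i` is at most `k` (and positive). -/
def prefixCount (S : Finset ℕ) (pos : ℕ → ℕ) (k : ℕ) : ℕ :=
  (S.filter fun i => pos i ∈ Finset.Icc 1 k).card

theorem prefixCount_zero (S : Finset ℕ) (pos : ℕ → ℕ) : prefixCount S pos 0 = 0 := by
  simp [prefixCount]

theorem prefixCount_mono (S : Finset ℕ) (pos : ℕ → ℕ) : Monotone (prefixCount S pos) := by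
  intro a b hab
  refine Finset.card_le_card fun i hi => ?_
  simp only [Finset.mem_filter, Finset.mem_Icc] at hi ⊢
  exact ⟨hi.1, hi.2.1, hi.2.2.trans hab⟩

theorem prefixCount_le_card (S : Finset ℕ) (pos : ℕ → ℕ) (k : ℕ) :
    prefixCount S pos k ≤ S.card :=
  Finset.card_filter_le _ _

theorem prefixCount_eq_card {S : Finset ℕ} {pos : ℕ → ℕ} {k : ℕ}
    (hpos : ∀ i ∈ S, pos i ∈ Finset.Icc 1 k) : prefixCount S pos k = S.card := by
  rw [prefixCount, Finset.filter_true_of_mem hpos]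

theorem prefixCount_succ_of_forall_ne {S : Finset ℕ} {pos : ℕ → ℕ} {k : ℕ}
    (hpos : ∀ i ∈ S, pos i ≠ k + 1) : prefixCount S pos (k + 1) = prefixCount S pos k := by
  refine congrArg Finset.card (Finset.filter_congr fun i hi => ?_)
  have := hpos i hi
  simp only [Finset.mem_Icc]
  omega

/-- Edges on a cyclic subpath are counted by differences of prefix counts. -/
theorem card_filter_steps (S : Finset ℕ) (pos : ℕ → ℕ) {ℓ h a b : ℕ}
    (ha : a ≤ ℓ + h) :
    ((S.filter fun i => pos i ∈ steps ℓ h a b).card : ℤ) =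
      prefixCount S pos b - prefixCount S pos a +
        if a ≤ b then 0 else (prefixCount S pos (ℓ + h) : ℤ) := by
  unfold prefixCount steps
  split_ifs with hab
  · simp only [Finset.card_filter, Finset.mem_Icc]
    push_cast
    rw [add_zero, ← Finset.sum_sub_distrib]
    refine Finset.sum_congr rfl fun i _ => ?_
    split_ifs <;> omega
  · simp only [Finset.card_filter, Finset.mem_Icc, Finset.mem_union]
    push_cast
    rw [← Finset.sum_sub_distrib, ← Finset.sum_add_distrib]
    refine Finset.sum_congr rfl fun i _ => ?_
    split_ifs <;> omega

theorem posE_mem_Icc {ℓ h i : ℕ} (hi : i ∈ Finset.Icc 1 ℓ) :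
    posE ℓ h i ∈ Finset.Icc 1 (ℓ + h) := by
  rw [Finset.mem_Icc] at hi ⊢
  have : northBefore ℓ h i ≤ h :=
    Nat.div_le_of_le_mul (Nat.mul_le_mul_right h hi.2)
  unfold posE
  omega

theorem posN_mem_Icc {ℓ h j : ℕ} (hj : j ∈ Finset.Icc 1 h) :
    posN ℓ h j ∈ Finset.Icc 1 (ℓ + h) := by
  rw [Finset.mem_Icc] at hj ⊢
  have : eastBefore ℓ h j ≤ ℓ := by
    simpa [eastBefore] using Finset.card_filter_le (Finset.Icc 1 ℓ) fun i => northBefore ℓ h i < j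
  unfold posN
  omega

/-- If `r·|S₂| > ℓ`, the cycle lemma yields an edge `ν_j ∈ S₂` such that no nonempty cyclic
subpath ending at its top endpoint has as many horizontal edges as `r` times its number of
edges in `S₂`. -/
theorem exists_vertical_edge_unshadowed {r : ℤ} {ℓ h : ℕ} {S2 : Finset ℕ}
    (hS2 : S2 ⊆ Finset.Icc 1 h) (hbig : (ℓ : ℤ) < r * S2.card) :
    ∃ j ∈ S2, ∀ m ≤ ℓ + h, m ≠ pN ℓ h j →
      (hIn ℓ h (steps ℓ h m (pN ℓ h j)) : ℤ) ≠
        r * (vInS ℓ h S2 (steps ℓ h m (pN ℓ h j)) : ℤ) := by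
  set G : ℕ → ℤ := fun k =>
    prefixCount (Finset.Icc 1 ℓ) (posE ℓ h) k - r * prefixCount S2 (posN ℓ h) k with hG
  have hG0 : G 0 = 0 := by simp [hG, prefixCount_zero]
  have hGN : G (ℓ + h) < 0 := by
    have h1 := prefixCount_le_card (Finset.Icc 1 ℓ) (posE ℓ h) (ℓ + h)
    have h2 : prefixCount S2 (posN ℓ h) (ℓ + h) = S2.card :=
      prefixCount_eq_card fun j hj => posN_mem_Icc (hS2 hj)
    rw [Nat.card_Icc, Nat.add_sub_cancel] at h1
    simp only [hG, h2]
    have : (prefixCount (Finset.Icc 1 ℓ) (posE ℓ h) (ℓ + h) : ℤ) ≤ ℓ := by exact_mod_cast h1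
    linarith
  have hmin : ∃ b, b ≤ ℓ + h ∧ ∀ m ≤ ℓ + h, G b ≤ G m := by
    obtain ⟨b, hb, hb'⟩ := Finset.exists_min_image (Finset.range (ℓ + h + 1)) G ⟨0, by simp⟩
    refine ⟨b, by simpa [Nat.lt_succ_iff] using hb, fun m hm => hb' m ?_⟩
    simpa [Nat.lt_succ_iff] using hm
  classical
  obtain ⟨b, ⟨hbN, hb⟩, hfirst⟩ : ∃ b, (b ≤ ℓ + h ∧ ∀ m ≤ ℓ + h, G b ≤ G m) ∧
      ∀ m < b, ¬ (m ≤ ℓ + h ∧ ∀ k ≤ ℓ + h, G m ≤ G k) :=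
    ⟨Nat.find hmin, Nat.find_spec hmin, fun _ => Nat.find_min hmin⟩
  have hlt : ∀ m < b, G b < G m := by
    intro m hm
    by_contra! hle
    exact hfirst m hm ⟨by omega, fun k hk => hle.trans (hb k hk)⟩
  obtain ⟨k, rfl⟩ : ∃ k, b = k + 1 := by
    refine Nat.exists_eq_succ_of_ne_zero ?_
    rintro rfl
    have := hb (ℓ + h) le_rfl
    omega
  obtain ⟨j, hj, hjk⟩ : ∃ j ∈ S2, posN ℓ h j = k + 1 := by
    by_contra! hne
    have h1 := hlt k (Nat.lt_succ_self k)
    have h2 := prefixCount_mono (Finset.Icc 1 ℓ) (posE ℓ h) (Nat.le_succ k)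
    simp only [hG, prefixCount_succ_of_forall_ne hne] at h1
    have : (prefixCount (Finset.Icc 1 ℓ) (posE ℓ h) k : ℤ) ≤
        prefixCount (Finset.Icc 1 ℓ) (posE ℓ h) (k + 1) := by exact_mod_cast h2
    linarith
  refine ⟨j, hj, fun m hm hne heq => ?_⟩
  rw [pN, hjk] at hne heq
  rw [hIn, vInS, card_filter_steps _ _ hm, card_filter_steps _ _ hm] at heq
  have h1 := hb m hm
  have h2 := hlt m
  simp only [hG] at h1 h2 hGN
  split_ifs at heq with hle
  · have := h2 (by omega)
    linarith
  · linarith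

/-- In a compatible pair with `r·|S₂| > ℓ`, the horizontal part satisfies `r·|S₁| ≤ h`. -/
theorem Compatible.mul_card_fst_le {r : ℤ} {ℓ h : ℕ} {S1 S2 : Finset ℕ}
    (hcomp : Compatible r ℓ h S1 S2) (hbig : (ℓ : ℤ) < r * S2.card) :
    r * S1.card ≤ h := by
  obtain ⟨hS1, hS2, hcomp⟩ := hcomp
  obtain ⟨j, hj, hunsh⟩ := exists_vertical_edge_unshadowed hS2 hbig
  have hbN := (Finset.mem_Icc.1 (posN_mem_Icc (ℓ := ℓ) (hS2 hj))).2
  rw [← pN] at hbN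
  have hcond := fun i hi => hcomp i hi j hj
  generalize pN ℓ h j = b at hunsh hbN hcond
  set K : ℕ → ℤ := fun k =>
    prefixCount (Finset.Icc 1 h) (posN ℓ h) k - r * prefixCount S1 (posE ℓ h) k with hK
  have hK0 : K 0 = 0 := by simp [hK, prefixCount_zero]
  have hKN : K (ℓ + h) ≤ h - r * S1.card := by
    have h1 := prefixCount_le_card (Finset.Icc 1 h) (posN ℓ h) (ℓ + h)
    have h2 : prefixCount S1 (posE ℓ h) (ℓ + h) = S1.card :=
      prefixCount_eq_card fun i hi => posE_mem_Icc (hS1 hi)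
    rw [Nat.card_Icc, Nat.add_sub_cancel] at h1
    simp only [hK, h2]
    have : (prefixCount (Finset.Icc 1 h) (posN ℓ h) (ℓ + h) : ℤ) ≤ h := by exact_mod_cast h1
    linarith
  have hstep : ∀ k, K k ≤ K (k + 1) ∨ ∃ m ∈ pts ℓ h k b, m ≠ k ∧ m ≠ b ∧
      K m - K k + (if k ≤ m then 0 else K (ℓ + h)) = 0 := by
    intro k
    by_cases hex : ∃ i ∈ S1, posE ℓ h i = k + 1
    · right
      obtain ⟨i, hi, hik⟩ := hex
      have hkN := (Finset.mem_Icc.1 (posE_mem_Icc (h := h) (hS1 hi))).2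
      obtain ⟨m, hm, hmk, hmb, heq⟩ := hcond i hi
      have hpE : pE ℓ h i = k := by simp [pE, hik]
      rw [hpE] at hm hmk heq
      have hmN : m ≤ ℓ + h := by
        unfold pts at hm
        split_ifs at hm <;> simp only [Finset.mem_union, Finset.mem_Icc] at hm <;> omega
      replace heq := heq.resolve_left (hunsh m hmN hmb)
      rw [vIn, hInS, card_filter_steps _ _ (by omega), card_filter_steps _ _ (by omega)] at heq
      refine ⟨m, hm, hmk, hmb, ?_⟩
      simp only [hK]
      split_ifs at heq ⊢ <;> linarith
    · left
      push Not at hex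
      have h2 := prefixCount_mono (Finset.Icc 1 h) (posN ℓ h) (Nat.le_succ k)
      simp only [hK, prefixCount_succ_of_forall_ne hex]
      have : (prefixCount (Finset.Icc 1 h) (posN ℓ h) k : ℤ) ≤
          prefixCount (Finset.Icc 1 h) (posN ℓ h) (k + 1) := by exact_mod_cast h2
      linarith
  have hbefore : ∀ d k, k + d = b → K k ≤ K b := by
    intro d
    induction d using Nat.strong_induction_on with
    | _ d ih =>
      rintro k rfl
      rcases Nat.eq_zero_or_pos d with rfl | hd
      · simp
      rcases hstep k with hle | ⟨m, hm, hmk, hmb, heq⟩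
      · exact hle.trans (ih (d - 1) (by omega) (k + 1) (by omega))
      · rw [pts, if_pos (by omega), Finset.mem_Icc] at hm
        rw [if_pos hm.1] at heq
        have := ih (k + d - m) (by omega) m (by omega)
        linarith
  have hbefore' : ∀ k ≤ b, K k ≤ K b := fun k hk => hbefore (b - k) k (by omega)
  have hafter : ∀ d k, b ≤ k → k + d = ℓ + h → K k ≤ K (ℓ + h) + K b := by
    intro d
    induction d using Nat.strong_induction_on with
    | _ d ih =>
      intro k hbk hkd
      rcases Nat.eq_zero_or_pos d with rfl | hd
      · have := hbefore' 0 (Nat.zero_le b)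
        rw [← hkd]
        simp only [add_zero]
        linarith
      rcases hstep k with hle | ⟨m, hm, hmk, hmb, heq⟩
      · exact hle.trans (ih (d - 1) (by omega) (k + 1) (by omega) (by omega))
      · have hbk' : b ≠ k := by
          rintro rfl
          simp [pts] at hm
          omega
        rw [pts, if_neg (by omega), Finset.mem_union, Finset.mem_Icc, Finset.mem_Icc] at hm
        split_ifs at heq with hkm
        · have := ih (ℓ + h - m) (by omega) m (by omega) (by omega)
          linarith
        · have := hbefore' m (by omega)
          linarith
  have := hafter (ℓ + h - b) b le_rfl (by omega)
  linarith

/-- A Chernoff-type bound for the number of subsets of `U` of size at most `m / 3`. -/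
theorem card_small_subsets_pow_le (U : Finset ℕ) (m : ℕ) :
    (U.powerset.filter fun S => 3 * S.card ≤ m).card ^ 5 ≤ 2 ^ (5 * m + U.card) := by
  set A := U.powerset.filter fun S => 3 * S.card ≤ m with hA
  have hsum : A.card * 8 ^ U.card ≤ 2 ^ m * 9 ^ U.card := by
    have h9 := Finset.sum_pow_mul_eq_add_pow (1 : ℕ) 8 U
    norm_num at h9
    rw [← h9, Finset.mul_sum, ← smul_eq_mul, ← Finset.sum_const]
    refine (Finset.sum_le_sum fun S hS => ?_).trans
      (Finset.sum_le_sum_of_subset (Finset.filter_subset _ _))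
    rw [hA, Finset.mem_filter, Finset.mem_powerset] at hS
    have hcard := Finset.card_le_card hS.1
    calc 8 ^ U.card = 2 ^ (3 * S.card) * 8 ^ (U.card - S.card) := by
          rw [pow_mul, show (2 : ℕ) ^ 3 = 8 by norm_num, ← pow_add, Nat.add_sub_cancel' hcard]
      _ ≤ 2 ^ m * 8 ^ (U.card - S.card) :=
          Nat.mul_le_mul_right _ (Nat.pow_le_pow_right (by norm_num) hS.2)
  have h8 : 0 < (8 ^ U.card) ^ 5 := by positivity
  refine Nat.le_of_mul_le_mul_right ?_ h8
  calc A.card ^ 5 * (8 ^ U.card) ^ 5 = (A.card * 8 ^ U.card) ^ 5 := by ring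
    _ ≤ (2 ^ m * 9 ^ U.card) ^ 5 := Nat.pow_le_pow_left hsum 5
    _ = 2 ^ (5 * m) * (9 ^ 5) ^ U.card := by
        rw [mul_pow, ← pow_mul, ← pow_mul, ← pow_mul, mul_comm m, mul_comm U.card]
    _ ≤ 2 ^ (5 * m) * (2 * 8 ^ 5) ^ U.card :=
        Nat.mul_le_mul_left _ (Nat.pow_le_pow_left (by norm_num) _)
    _ = 2 ^ (5 * m + U.card) * (8 ^ U.card) ^ 5 := by
        rw [mul_pow, pow_add, ← pow_mul, ← pow_mul, mul_comm U.card 5, mul_assoc]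

theorem mem_CP {r : ℤ} {ℓ h : ℕ} {p : Finset ℕ × Finset ℕ} :
    p ∈ CP r ℓ h ↔ Compatible r ℓ h p.1 p.2 := by
  simp only [CP, Finset.mem_filter, Finset.mem_product, Finset.mem_powerset,
    and_iff_right_iff_imp]
  exact fun hp => ⟨hp.1, hp.2.1⟩

theorem two_pow_le_card_CP (r : ℤ) (ℓ h : ℕ) : 2 ^ ℓ ≤ (CP r ℓ h).card := by
  have hcard : (Finset.Icc 1 ℓ).powerset.card = 2 ^ ℓ := by simp
  rw [← hcard]
  refine Finset.card_le_card_of_injOn (fun S => (S, ∅)) (fun S hS => ?_)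
    (fun S _ T _ hST => congrArg Prod.fst hST)
  rw [Finset.mem_coe, mem_CP]
  exact ⟨Finset.mem_powerset.1 hS, Finset.empty_subset _, by simp⟩

/-- With `r ≥ 3` and `r·h ≤ ℓ + q`, the pairs with `r·|S₂| > ℓ` have `S₁` of size at most `h / 3`
and complement of `S₂` of size at most `q / 3`. -/
theorem card_bad_pow_le {r : ℤ} (hr : 3 ≤ r) {ℓ h q : ℕ} (hq : r * h ≤ ℓ + q) :
    ((CP r ℓ h).filter fun p => (ℓ : ℤ) < r * (p.2.card : ℤ)).card ^ 5 ≤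
      2 ^ (5 * h + ℓ) * 2 ^ (5 * q + h) := by
  have hA := card_small_subsets_pow_le (Finset.Icc 1 ℓ) h
  have hB := card_small_subsets_pow_le (Finset.Icc 1 h) q
  rw [Nat.card_Icc, Nat.add_sub_cancel] at hA hB
  refine le_trans ?_ (Nat.mul_le_mul hA hB)
  rw [← mul_pow, ← Finset.card_product]
  refine Nat.pow_le_pow_left (Finset.card_le_card_of_injOn
    (fun p => (p.1, Finset.Icc 1 h \ p.2)) (fun p hp => ?_) (fun p hp p' hp' heq => ?_)) 5
  · obtain ⟨hcp, hbig⟩ := Finset.mem_filter.1 (Finset.mem_coe.1 hp)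
    have hcomp := mem_CP.1 hcp
    have h1 := hcomp.mul_card_fst_le hbig
    have h2 := Finset.card_sdiff_add_card_eq_card hcomp.2.1
    rw [Nat.card_Icc, Nat.add_sub_cancel] at h2
    simp only [Finset.coe_product, Set.mem_prod, Finset.mem_coe, Finset.mem_filter,
      Finset.mem_powerset]
    refine ⟨⟨hcomp.1, ?_⟩, Finset.sdiff_subset, ?_⟩
    · have : (3 * p.1.card : ℤ) ≤ h := by nlinarith
      exact_mod_cast this
    · have h2' : ((Finset.Icc 1 h \ p.2).card : ℤ) + p.2.card = h := by exact_mod_cast h2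
      have : (3 * (Finset.Icc 1 h \ p.2).card : ℤ) ≤ q := by
        rw [← h2'] at hq
        nlinarith
      exact_mod_cast this
  · have hs := (mem_CP.1 (Finset.mem_filter.1 (Finset.mem_coe.1 hp)).1).2.1
    have hs' := (mem_CP.1 (Finset.mem_filter.1 (Finset.mem_coe.1 hp')).1).2.1
    obtain ⟨h1, h2⟩ := Prod.mk.inj heq
    refine Prod.ext h1 ?_
    rw [← Finset.sdiff_sdiff_eq_self hs, h2, Finset.sdiff_sdiff_eq_self hs']

end CPwork

open CPwork in
/-- Fix `r ≥ 3` and `n ≥ 3`, and let `P = P(c(n+1), c n)`.  Let `CP_bad(P)` be the set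
of compatible pairs `(S₁,S₂)` on `P` with `r·|S₂| > c(n+1)`.  Then
`2^{c(n−2)} · |CP_bad(P)| ≤ |CP(P)|`. -/
theorem card_bad_compatible_pairs_le
    (r : ℤ) (hr : 3 ≤ r) (c : ℕ → ℤ)
    (hc0 : c 0 = -1) (hc1 : c 1 = 0)
    (hcrec : ∀ n, 1 ≤ n → c (n + 1) = r * c n - c (n - 1))
    (n : ℕ) (hn : 3 ≤ n) :
    2 ^ (c (n - 2)).toNat *
        ((CP r ((c (n + 1)).toNat) ((c n).toNat)).filter
          (fun p => c (n + 1) < r * (p.2.card : ℤ))).card ≤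
      (CP r ((c (n + 1)).toNat) ((c n).toNat)).card := by
  have hgrowth : ∀ k, 0 ≤ c (k + 1) ∧ 2 * c (k + 1) ≤ c (k + 2) := by
    intro k
    induction k with
    | zero =>
      have := hcrec 1 le_rfl
      norm_num [hc0, hc1] at this
      norm_num [hc1, this]
    | succ k ih =>
      have := hcrec (k + 2) (by omega)
      rw [show k + 2 - 1 = k + 1 by omega] at this
      refine ⟨by linarith, ?_⟩
      show 2 * c (k + 2) ≤ c (k + 2 + 1)
      nlinarith
  obtain ⟨k, rfl⟩ : ∃ k, n = k + 3 := ⟨n - 3, by omega⟩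
  obtain ⟨h1, h12⟩ := hgrowth k
  have h23 := (hgrowth (k + 1)).2
  have h34 := (hgrowth (k + 2)).2
  have hrec3 := hcrec (k + 2) (by omega)
  have hrec4 := hcrec (k + 3) (by omega)
  rw [show k + 2 - 1 = k + 1 by omega] at hrec3
  rw [show k + 3 - 1 = k + 2 by omega] at hrec4
  rw [show k + 3 - 2 = k + 1 by omega]
  simp only [add_assoc, Nat.reduceAdd] at *
  lift c (k + 1) to ℕ using h1 with e
  lift c (k + 2) to ℕ using by omega with q
  lift c (k + 3) to ℕ using by omega with h
  lift c (k + 4) to ℕ using by omega with ℓ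
  simp only [Int.toNat_natCast]
  have hbad := card_bad_pow_le hr (ℓ := ℓ) (h := h) (q := q) (by linarith)
  have hexp : 5 * e + (5 * h + ℓ + (5 * q + h)) ≤ 5 * ℓ := by
    have hq : (3 * q : ℤ) ≤ r * q := by nlinarith
    have hh : (3 * h : ℤ) ≤ r * h := by nlinarith
    omega
  refine (Nat.pow_le_pow_iff_left (n := 5) (by norm_num)).1 ?_
  calc _ ≤ 2 ^ (5 * e) * (2 ^ (5 * h + ℓ) * 2 ^ (5 * q + h)) := by
        rw [mul_pow, ← pow_mul, mul_comm e 5]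
        exact Nat.mul_le_mul_left _ hbad
    _ = 2 ^ (5 * e + (5 * h + ℓ + (5 * q + h))) := by rw [← pow_add, ← pow_add]
    _ ≤ 2 ^ (5 * ℓ) := Nat.pow_le_pow_right (by norm_num) hexp
    _ = (2 ^ ℓ) ^ 5 := by rw [mul_comm, pow_mul]
    _ ≤ _ := Nat.pow_le_pow_left (two_pow_le_card_CP r ℓ h) 5
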